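/- arXiv:1906.05066 — 3 statements merged into one kernel-verified Lean document; each statement's English description precedes it below -/
import Mathlib

section
/- Let C be a finite satisfiable set of linear atomic constraints over a finite set of arguments 𝒜, let P be a probability function over 𝒜, and let P* = 𝒰²_At(P,C) be the result of the two-stage least-squares update. Then 𝒰²_At(P*,C) = P*, i.e., the two-stage least-squares update operator is idempotent. -/
open Finset

/-- A probability function over the possible worlds `Ω = 2^𝒜` (represented as `Finset α`):
maps each world into `[0,1]` and sums to `1`. -/
def IsProbFun {α : Type*} [Fintype α] (P : Finset α → ℝ) : Prop :=
  (∀ w, 0 ≤ P w ∧ P w ≤ 1) ∧ ∑ w : Finset α, P w = 1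

/-- The probability of an argument `A` under `P`: the sum of the probabilities of all
worlds accepting `A`. -/
def argProb {α : Type*} [Fintype α] [DecidableEq α] (P : Finset α → ℝ) (A : α) : ℝ :=
  ∑ w : Finset α, if A ∈ w then P w else 0

/-- A probability function satisfies the linear atomic constraint `c = ((c_A)_A, c₀)`
iff `∑_A c_A · P(A) ≤ c₀`. -/
def SatP {α : Type*} [Fintype α] [DecidableEq α] (P : Finset α → ℝ)
    (c : (α → ℚ) × ℚ) : Prop :=
  ∑ A : α, (c.1 A : ℝ) * argProb P A ≤ (c.2 : ℝ)

/-- `sat_Π(C)`: the set of probability functions satisfying every constraint in `C`. -/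
def satPi {α : Type*} [Fintype α] [DecidableEq α] (C : Finset ((α → ℚ) × ℚ)) :
    Set (Finset α → ℝ) :=
  {P | IsProbFun P ∧ ∀ c ∈ C, SatP P c}

/-- The atomic least-squares distance `d²_At`. -/
def dAt {α : Type*} [Fintype α] [DecidableEq α] (P P' : Finset α → ℝ) : ℝ :=
  ∑ A : α, (argProb P A - argProb P' A) ^ 2

/-- `u_At(P,C)`: the ALS-distance minimizers to `P` within `sat_Π(C)`. -/
def uAt {α : Type*} [Fintype α] [DecidableEq α] (P : Finset α → ℝ)
    (C : Finset ((α → ℚ) × ℚ)) : Set (Finset α → ℝ) :=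
  {P' ∈ satPi C | ∀ Q ∈ satPi C, dAt P P' ≤ dAt P Q}

/-- The (world-wise) least-squares distance `∑_{w ∈ Ω} (P(w) - P'(w))²`. -/
def wDist {α : Type*} [Fintype α] (P P' : Finset α → ℝ) : ℝ :=
  ∑ w : Finset α, (P w - P' w) ^ 2

/-- A probability labelling: maps each argument into `[0,1]`. -/
def IsLab {α : Type*} (L : α → ℝ) : Prop := ∀ A, 0 ≤ L A ∧ L A ≤ 1

/-- A probability labelling satisfies the linear atomic constraint `c = ((c_A)_A, c₀)`
iff `∑_A c_A · L(A) ≤ c₀`. -/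
def SatL {α : Type*} [Fintype α] (L : α → ℝ) (c : (α → ℚ) × ℚ) : Prop :=
  ∑ A : α, (c.1 A : ℝ) * L A ≤ (c.2 : ℝ)

/-- `sat_Λ(C)`: the set of probability labellings satisfying every constraint in `C`. -/
def satLam {α : Type*} [Fintype α] (C : Finset ((α → ℚ) × ℚ)) : Set (α → ℝ) :=
  {L | IsLab L ∧ ∀ c ∈ C, SatL L c}

theorem dAt_self {α : Type*} [Fintype α] [DecidableEq α] (P : Finset α → ℝ) : dAt P P = 0 := by
  simp [dAt]

theorem dAt_nonneg {α : Type*} [Fintype α] [DecidableEq α] (P P' : Finset α → ℝ) :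
    0 ≤ dAt P P' :=
  Finset.sum_nonneg fun _ _ => sq_nonneg _

theorem wDist_self {α : Type*} [Fintype α] (P : Finset α → ℝ) : wDist P P = 0 := by
  simp [wDist]

theorem eq_of_wDist_nonpos {α : Type*} [Fintype α] {P P' : Finset α → ℝ}
    (h : wDist P P' ≤ 0) : P = P' := by
  have hnn : ∀ w ∈ (Finset.univ : Finset (Finset α)), 0 ≤ (P w - P' w) ^ 2 :=
    fun _ _ => sq_nonneg _
  have h0 := (Finset.sum_eq_zero_iff_of_nonneg hnn).1 (le_antisymm h (Finset.sum_nonneg hnn))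
  funext w
  exact sub_eq_zero.1 (pow_eq_zero_iff two_ne_zero |>.1 (h0 w (Finset.mem_univ w)))

/-- A probability function satisfying the constraints is among its own ALS-minimizers. -/
theorem mem_uAt_self {α : Type*} [Fintype α] [DecidableEq α] {C : Finset ((α → ℚ) × ℚ)}
    {P : Finset α → ℝ} (hP : P ∈ satPi C) : P ∈ uAt P C :=
  ⟨hP, fun Q _ => (dAt_self P).trans_le (dAt_nonneg P Q)⟩

/-- Idempotence: if `P*` is the two-stage least-squares update of `P` by `C`,
then the two-stage least-squares update of `P*` by `C` is `P*` itself. -/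
theorem two_stage_update_idempotent {α : Type*} [Fintype α] [DecidableEq α]
    (C : Finset ((α → ℚ) × ℚ)) (hC : (satPi C).Nonempty)
    (P : Finset α → ℝ) (hP : IsProbFun P)
    (Pstar : Finset α → ℝ)
    (hPstar : Pstar ∈ uAt P C ∧ ∀ Q ∈ uAt P C, wDist P Pstar ≤ wDist P Q)
    (Q : Finset α → ℝ)
    (hQ : Q ∈ uAt Pstar C ∧ ∀ Q' ∈ uAt Pstar C, wDist Pstar Q ≤ wDist Pstar Q') :
    Q = Pstar := by
  have h := hQ.2 Pstar (mem_uAt_self hPstar.1.1)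
  rw [wDist_self] at h
  exact (eq_of_wDist_nonpos h).symm
end

section
/- Let P₁ be a probability function over a finite set of arguments 𝒜 and let C be a finite set of linear atomic constraints over 𝒜. Then any two probability functions P₁', P₂' ∈ u_At(P₁,C) are atomically equivalent, i.e., P₁'(A) = P₂'(A) for all A ∈ 𝒜. -/
open Finset

/-- Argument probabilities commute with taking midpoints of functions on worlds. -/
theorem argProb_midpoint {α : Type*} [Fintype α] [DecidableEq α] (P Q : Finset α → ℝ) (A : α) :
    argProb (fun w => (P w + Q w) / 2) A = (argProb P A + argProb Q A) / 2 := by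
  unfold argProb
  rw [← Finset.sum_add_distrib, Finset.sum_div]
  refine Finset.sum_congr rfl fun w _ => ?_
  split_ifs <;> simp

/-- The set `satPi C` is closed under midpoints. -/
theorem midpoint_mem_satPi {α : Type*} [Fintype α] [DecidableEq α] {C : Finset ((α → ℚ) × ℚ)}
    {P Q : Finset α → ℝ} (hP : P ∈ satPi C) (hQ : Q ∈ satPi C) :
    (fun w => (P w + Q w) / 2) ∈ satPi C := by
  obtain ⟨⟨hP01, hPsum⟩, hPC⟩ := hP
  obtain ⟨⟨hQ01, hQsum⟩, hQC⟩ := hQ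
  refine ⟨⟨fun w => ?_, ?_⟩, fun c hc => ?_⟩
  · have h := hP01 w
    have h' := hQ01 w
    constructor <;> linarith
  · rw [← Finset.sum_div, Finset.sum_add_distrib, hPsum, hQsum]
    norm_num
  · have h := hPC c hc
    have h' := hQC c hc
    unfold SatP at *
    have heq : ∑ A, (c.1 A : ℝ) * argProb (fun w => (P w + Q w) / 2) A =
        (∑ A, (c.1 A : ℝ) * argProb P A + ∑ A, (c.1 A : ℝ) * argProb Q A) / 2 := by
      rw [← Finset.sum_add_distrib, Finset.sum_div]
      refine Finset.sum_congr rfl fun A _ => ?_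
      rw [argProb_midpoint]
      ring
    linarith

/-- The parallelogram law for the atomic least-squares distance. -/
theorem dAt_midpoint {α : Type*} [Fintype α] [DecidableEq α] (R P Q : Finset α → ℝ) :
    dAt R (fun w => (P w + Q w) / 2) = (dAt R P + dAt R Q) / 2 - dAt P Q / 4 := by
  unfold dAt
  rw [← Finset.sum_add_distrib, Finset.sum_div, Finset.sum_div, ← Finset.sum_sub_distrib]
  refine Finset.sum_congr rfl fun A _ => ?_
  rw [argProb_midpoint]
  ring

/-- any two elements of `u_At(P₁,C)` are atomically equivalent. -/
theorem uAt_elements_atomEquiv {α : Type*} [Fintype α] [DecidableEq α]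
    (P₁ : Finset α → ℝ) (h₁ : IsProbFun P₁) (C : Finset ((α → ℚ) × ℚ))
    (P₁' P₂' : Finset α → ℝ) (h₁' : P₁' ∈ uAt P₁ C) (h₂' : P₂' ∈ uAt P₁ C) :
    ∀ A : α, argProb P₁' A = argProb P₂' A := by
  intro A
  have hle := h₁'.2 _ (midpoint_mem_satPi h₁'.1 h₂'.1)
  have hle' := h₂'.2 _ h₁'.1
  rw [dAt_midpoint] at hle
  have hdist : dAt P₁' P₂' ≤ 0 := by linarith
  have hterm : (argProb P₁' A - argProb P₂' A) ^ 2 ≤ dAt P₁' P₂' :=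
    Finset.single_le_sum (f := fun A => (argProb P₁' A - argProb P₂' A) ^ 2)
      (fun _ _ => sq_nonneg _) (Finset.mem_univ A)
  have hzero : (argProb P₁' A - argProb P₂' A) ^ 2 = 0 :=
    le_antisymm (hterm.trans hdist) (sq_nonneg _)
  exact sub_eq_zero.mp (pow_eq_zero_iff two_ne_zero |>.mp hzero)
end

section
/- Let C be a finite satisfiable set of linear atomic constraints over a finite set of arguments 𝒜, let P be a probability function over 𝒜 with induced labelling L_P (L_P(A) = P(A)), and let L* be the unique minimizer of ∑_{A ∈ 𝒜} (L_P(A) − L'(A))² over L' ∈ sat_Λ(C). Then for every P' ∈ u_At(P,C), the induced labelling of P' equals L*: P'(A) = L*(A) for all A ∈ 𝒜. -/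
open Finset

/-- The probability function making the arguments independent with probabilities `L A`. -/
def indepProb {α : Type*} [Fintype α] [DecidableEq α] (L : α → ℝ) (w : Finset α) : ℝ :=
  (∏ A ∈ w, L A) * ∏ A ∈ univ \ w, (1 - L A)

theorem isProbFun_of_nonneg {α : Type*} [Fintype α] {P : Finset α → ℝ}
    (h0 : ∀ w, 0 ≤ P w) (h1 : ∑ w, P w = 1) : IsProbFun P :=
  ⟨fun w => ⟨h0 w, h1 ▸ single_le_sum (fun v _ => h0 v) (mem_univ w)⟩, h1⟩

theorem isProbFun_indepProb {α : Type*} [Fintype α] [DecidableEq α] {L : α → ℝ}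
    (hL : IsLab L) : IsProbFun (indepProb L) := by
  refine isProbFun_of_nonneg (fun w => ?_) ?_
  · exact mul_nonneg (prod_nonneg fun A _ => (hL A).1)
      (prod_nonneg fun A _ => sub_nonneg.2 (hL A).2)
  · have h := prod_add L (fun A => 1 - L A) univ
    simp only [add_sub_cancel, prod_const_one, powerset_univ] at h
    exact h.symm

theorem argProb_indepProb {α : Type*} [Fintype α] [DecidableEq α] (L : α → ℝ) (A : α) :
    argProb (indepProb L) A = L A := by
  have h := prod_add L (Function.update (fun B => 1 - L B) A 0) univ
  rw [powerset_univ, prod_eq_single A] at h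
  · rw [Function.update_self, add_zero] at h
    rw [h, argProb]
    refine sum_congr rfl fun w _ => ?_
    split_ifs with hA
    · rw [indepProb]
      congr 1
      refine prod_congr rfl fun B hB => ?_
      rw [Function.update_of_ne]
      rintro rfl
      exact (mem_sdiff.1 hB).2 hA
    · rw [prod_eq_zero (i := A) (s := univ \ w) (by simp [hA]) (by simp), mul_zero]
  · intro B _ hB
    simp [Function.update_of_ne hB]
  · simp

theorem isLab_argProb {α : Type*} [Fintype α] [DecidableEq α] {P : Finset α → ℝ}
    (hP : IsProbFun P) : IsLab (argProb P) := by
  intro A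
  refine ⟨sum_nonneg fun w _ => ?_, hP.2 ▸ sum_le_sum fun w _ => ?_⟩
  · split_ifs
    exacts [(hP.1 w).1, le_rfl]
  · split_ifs
    exacts [le_rfl, (hP.1 w).1]

theorem argProb_mem_satLam {α : Type*} [Fintype α] [DecidableEq α]
    {C : Finset ((α → ℚ) × ℚ)} {P : Finset α → ℝ} (hP : P ∈ satPi C) :
    argProb P ∈ satLam C :=
  ⟨isLab_argProb hP.1, hP.2⟩

theorem indepProb_mem_satPi {α : Type*} [Fintype α] [DecidableEq α]
    {C : Finset ((α → ℚ) × ℚ)} {L : α → ℝ} (hL : L ∈ satLam C) :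
    indepProb L ∈ satPi C := by
  refine ⟨isProbFun_indepProb hL.1, fun c hc => ?_⟩
  simpa only [SatP, SatL, argProb_indepProb] using hL.2 c hc

theorem midpoint_mem_satLam {α : Type*} [Fintype α] {C : Finset ((α → ℚ) × ℚ)}
    {L M : α → ℝ} (hL : L ∈ satLam C) (hM : M ∈ satLam C) :
    (fun A => (L A + M A) / 2) ∈ satLam C := by
  refine ⟨fun A => ?_, fun c hc => ?_⟩
  · have h₁ := hL.1 A
    have h₂ := hM.1 A
    constructor <;> linarith
  · have h₁ : ∑ A, (c.1 A : ℝ) * L A ≤ c.2 := hL.2 c hc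
    have h₂ : ∑ A, (c.1 A : ℝ) * M A ≤ c.2 := hM.2 c hc
    have h : ∑ A, (c.1 A : ℝ) * ((L A + M A) / 2) =
        (∑ A, (c.1 A : ℝ) * L A + ∑ A, (c.1 A : ℝ) * M A) / 2 := by
      rw [← sum_add_distrib, sum_div]
      exact sum_congr rfl fun A _ => by ring
    change ∑ A, (c.1 A : ℝ) * ((L A + M A) / 2) ≤ c.2
    linarith

theorem sum_sq_sub_midpoint {α : Type*} [Fintype α] (p L M : α → ℝ) :
    ∑ A, (p A - (L A + M A) / 2) ^ 2 =
      (∑ A, (p A - L A) ^ 2 + ∑ A, (p A - M A) ^ 2) / 2 - (∑ A, (L A - M A) ^ 2) / 4 := by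
  rw [← sum_add_distrib, sum_div, sum_div, ← sum_sub_distrib]
  exact sum_congr rfl fun A _ => by ring

/-- the labelling induced by any `P' ∈ u_At(P,C)` equals the unique
least-squares minimizer `L*` over `sat_Λ(C)` relative to the labelling `L_P` of `P`. -/
theorem uAt_labelling_eq_minimizer {α : Type*} [Fintype α] [DecidableEq α]
    (C : Finset ((α → ℚ) × ℚ)) (hC : (satPi C).Nonempty)
    (P : Finset α → ℝ) (hP : IsProbFun P)
    (Lstar : α → ℝ)
    (hLstar : Lstar ∈ satLam C ∧
      ∀ L' ∈ satLam C,
        (∑ A : α, (argProb P A - Lstar A) ^ 2) ≤ ∑ A : α, (argProb P A - L' A) ^ 2) :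
    ∀ P' ∈ uAt P C, ∀ A : α, argProb P' A = Lstar A := by
  intro P' hP' A
  have hle : ∑ A, (argProb P A - argProb P' A) ^ 2 ≤ ∑ A, (argProb P A - Lstar A) ^ 2 := by
    simpa only [dAt, argProb_indepProb] using hP'.2 _ (indepProb_mem_satPi hLstar.1)
  have hmid := hLstar.2 _ (midpoint_mem_satLam (argProb_mem_satLam hP'.1) hLstar.1)
  rw [sum_sq_sub_midpoint] at hmid
  have hA : (argProb P' A - Lstar A) ^ 2 ≤ ∑ B, (argProb P' B - Lstar B) ^ 2 :=
    single_le_sum (f := fun B => (argProb P' B - Lstar B) ^ 2)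
      (fun B _ => sq_nonneg _) (mem_univ A)
  have h0 : (argProb P' A - Lstar A) ^ 2 = 0 :=
    le_antisymm (by linarith) (sq_nonneg _)
  exact sub_eq_zero.1 (pow_eq_zero_iff two_ne_zero |>.1 h0)
end
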